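/- arXiv:2111.08837 — 6 statements merged into one kernel-verified Lean document; each statement's English description precedes it below -/
import Mathlib

section
/- Let G be a finite simple graph on vertex set [n], let W be any set of walks on G, and let p ∈ [0,1)^n. The following are equivalent: (1) p is valid for W; (2) for every equivalence class w̃ ∈ C(W) there exists r_{w̃} ∈ [0,1) such that p_{t(w̃)} ≤ r_{w̃} · ∏_{y∈Ext(w)} (1 − r_{ỹ}), where w is any representative of w̃ and the product ranges over the one-vertex extensions y ∈ Ext(w), each contributing the factor (1 − r_{ỹ}) for its class ỹ. -/
open Finset

variable {n : ℕ}

open Classical in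
/-- Walks are nonempty lists with the *terminal* vertex first; a one-vertex extension of `w`
is a list `z :: w`.  `extProd W L w = ∏_{y ∈ Ext(w)} (1 - L y)` where `Ext(w)` is the set of
one-vertex extensions of `w` belonging to `W`. -/
noncomputable def extProd (W : Set (List (Fin n))) (L : List (Fin n) → ℝ)
    (w : List (Fin n)) : ℝ :=
  ∏ z : Fin n, if z :: w ∈ W then 1 - L (z :: w) else 1

/-- `p` is valid for the set of walks `W`: there is `L : W → [0,1)` with
`p_{t(w)} ≤ L(w) ∏_{y ∈ Ext(w)} (1 - L(y))` for all `w ∈ W`. -/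
def IsValid (p : Fin n → ℝ) (W : Set (List (Fin n))) : Prop :=
  ∃ L : List (Fin n) → ℝ,
    (∀ w ∈ W, 0 ≤ L w ∧ L w < 1) ∧
    ∀ w, w ∈ W → ∀ h : w ≠ [], p (w.head h) ≤ L w * extProd W L w

/-- `w ∼ w'` in `W`: same terminal vertex (head of the reversed representation) and identical
sets of continuations within `W`. -/
def WalkEquiv (W : Set (List (Fin n))) (w w' : List (Fin n)) : Prop :=
  w.head? = w'.head? ∧ ∀ z : List (Fin n), z ++ w ∈ W ↔ z ++ w' ∈ W

theorem WalkEquiv.refl (W : Set (List (Fin n))) (w : List (Fin n)) : WalkEquiv W w w :=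
  ⟨rfl, fun _ => Iff.rfl⟩

theorem WalkEquiv.symm {W : Set (List (Fin n))} {w w' : List (Fin n)}
    (h : WalkEquiv W w w') : WalkEquiv W w' w :=
  ⟨h.1.symm, fun z => (h.2 z).symm⟩

theorem WalkEquiv.trans {W : Set (List (Fin n))} {u v w : List (Fin n)}
    (h : WalkEquiv W u v) (h' : WalkEquiv W v w) : WalkEquiv W u w :=
  ⟨h.1.trans h'.1, fun z => (h.2 z).trans (h'.2 z)⟩

theorem WalkEquiv.mem_iff {W : Set (List (Fin n))} {w w' : List (Fin n)}
    (h : WalkEquiv W w w') : w ∈ W ↔ w' ∈ W := by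
  simpa using h.2 []

theorem WalkEquiv.cons {W : Set (List (Fin n))} {w w' : List (Fin n)}
    (h : WalkEquiv W w w') (z : Fin n) : WalkEquiv W (z :: w) (z :: w') :=
  ⟨rfl, fun y => by simpa using h.2 (y ++ [z])⟩

/-- The infimum of `L` over the equivalence class of `w`. -/
noncomputable def classInf (W : Set (List (Fin n))) (L : List (Fin n) → ℝ)
    (w : List (Fin n)) : ℝ :=
  sInf (L '' {w' | WalkEquiv W w w'})

theorem classInf_congr {W : Set (List (Fin n))} {w w' : List (Fin n)}
    (L : List (Fin n) → ℝ) (h : WalkEquiv W w w') : classInf W L w = classInf W L w' := by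
  have hset : {u | WalkEquiv W w u} = {u | WalkEquiv W w' u} :=
    Set.ext fun _ => ⟨h.symm.trans, h.trans⟩
  rw [classInf, classInf, hset]

theorem le_classInf {W : Set (List (Fin n))} {L : List (Fin n) → ℝ} {w : List (Fin n)} {a : ℝ}
    (h : ∀ w', WalkEquiv W w w' → a ≤ L w') : a ≤ classInf W L w :=
  le_csInf ⟨L w, w, WalkEquiv.refl W w, rfl⟩ (by rintro _ ⟨w', hw', rfl⟩; exact h w' hw')

theorem classInf_le {W : Set (List (Fin n))} {L : List (Fin n) → ℝ}
    (hL : ∀ w ∈ W, 0 ≤ L w) {w w' : List (Fin n)} (hw : w ∈ W) (h : WalkEquiv W w w') :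
    classInf W L w ≤ L w' :=
  csInf_le ⟨0, by rintro _ ⟨u, hu, rfl⟩; exact hL u (hu.mem_iff.1 hw)⟩ ⟨w', h, rfl⟩

theorem extProd_pos {W : Set (List (Fin n))} {L : List (Fin n) → ℝ}
    (hL : ∀ w ∈ W, L w < 1) (w : List (Fin n)) : 0 < extProd W L w := by
  refine Finset.prod_pos fun z _ => ?_
  split_ifs with h
  · exact sub_pos.2 (hL _ h)
  · exact one_pos

theorem extProd_le_extProd_classInf {W : Set (List (Fin n))} {L : List (Fin n) → ℝ}
    (hL : ∀ w ∈ W, 0 ≤ L w ∧ L w < 1) {w w' : List (Fin n)} (h : WalkEquiv W w w') :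
    extProd W L w' ≤ extProd W (classInf W L) w := by
  refine Finset.prod_le_prod (fun z _ => ?_) fun z _ => ?_
  · split_ifs with hz
    · exact sub_nonneg.2 (hL _ hz).2.le
    · exact zero_le_one
  · have hc := h.cons z
    by_cases hz : z :: w ∈ W
    · rw [if_pos hz, if_pos (hc.mem_iff.1 hz)]
      exact sub_le_sub_left (classInf_le (fun u hu => (hL u hu).1) hz hc) 1
    · rw [if_neg hz, if_neg fun hz' => hz (hc.mem_iff.2 hz')]

/-- For any set of walks `W` on `G` and `p ∈ [0,1)ⁿ`, `p` is valid for `W`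
iff there is an assignment `r` of numbers in `[0,1)` to the equivalence classes of `W`
(i.e. a function on walks constant on classes) such that
`p_{t(w̃)} ≤ r_{w̃} ∏_{y ∈ Ext(w)} (1 - r_{ỹ})` for every class. -/
theorem valid_iff_classwise (G : SimpleGraph (Fin n)) (p : Fin n → ℝ)
    (hp : ∀ i, 0 ≤ p i ∧ p i < 1) (W : Set (List (Fin n)))
    (hW : ∀ w ∈ W, w ≠ [] ∧ w.Chain' G.Adj) :
    IsValid p W ↔
      ∃ r : List (Fin n) → ℝ,
        (∀ w ∈ W, ∀ w' ∈ W, WalkEquiv W w w' → r w = r w') ∧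
        (∀ w ∈ W, 0 ≤ r w ∧ r w < 1) ∧
        ∀ w, w ∈ W → ∀ h : w ≠ [], p (w.head h) ≤ r w * extProd W r w := by
  constructor
  · rintro ⟨L, hL, hvalid⟩
    have hlt : ∀ w ∈ W, classInf W L w < 1 := fun w hw =>
      (classInf_le (fun u hu => (hL u hu).1) hw (WalkEquiv.refl W w)).trans_lt (hL w hw).2
    refine ⟨classInf W L, fun w _ w' _ h => classInf_congr L h, fun w hw =>
      ⟨le_classInf fun w' h => (hL w' (h.mem_iff.1 hw)).1, hlt w hw⟩, fun w hw hne => ?_⟩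
    rw [← div_le_iff₀ (extProd_pos hlt w)]
    refine le_classInf fun w' h => ?_
    rw [div_le_iff₀ (extProd_pos hlt w)]
    have hw' : w' ∈ W := h.mem_iff.1 hw
    have hne' : w' ≠ [] := (hW w' hw').1
    have hhead : w.head hne = w'.head hne' := by
      have := h.1
      rwa [List.head?_eq_some_head hne, List.head?_eq_some_head hne', Option.some_inj] at this
    rw [hhead]
    exact (hvalid w' hw' hne').trans
      (mul_le_mul_of_nonneg_left (extProd_le_extProd_classInf hL h) (hL w' hw').1)
  · rintro ⟨r, -, hr, hvalid⟩
    exact ⟨r, hr, hvalid⟩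
end

section
/- (Non-backtracking LLL) Let G be a finite simple graph on vertex set [n] with edge set E, and p ∈ [0,1)^n. Let A = {(i,j) : {i,j} ∈ E} be the set of oriented edges, and for a = (i,j) ∈ A let Γ_a = {(j,k) ∈ A : k ≠ i}. If there exist numbers r_i ∈ [0,1) for each i ∈ [n] and r_a ∈ [0,1) for each a ∈ A such that for all i ∈ [n]: p_i ≤ r_i · ∏_{j∈Γ_i} (1 − r_{(j,i)}), and for all a = (i,j) ∈ A: p_j ≤ r_a · ∏_{y∈Γ_a} (1 − r_y), then Z_G(−p; S) > 0 for every S ⊆ [n] (i.e., p ∈ S(G)). -/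
open Finset

variable {n : ℕ}

open Classical in
/-- Independent set polynomial of the subgraph of `G` induced by `S`, i.e. `Z_G(x; S)`. -/
noncomputable def Zpoly (G : SimpleGraph (Fin n)) (x : Fin n → ℝ) (S : Finset (Fin n)) : ℝ :=
  ∑ I ∈ S.powerset.filter (fun I => ∀ a ∈ I, ∀ b ∈ I, ¬ G.Adj a b), ∏ i ∈ I, x i

open Classical in
theorem Zpoly_empty (G : SimpleGraph (Fin n)) (x : Fin n → ℝ) : Zpoly G x ∅ = 1 := by
  simp [Zpoly, Finset.filter_singleton]

open Classical in
/-- Deletion recurrence for the independent set polynomial. -/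
theorem Zpoly_insert (G : SimpleGraph (Fin n)) (x : Fin n → ℝ) {j : Fin n} {U : Finset (Fin n)}
    (hj : j ∉ U) :
    Zpoly G x (insert j U) = Zpoly G x U + x j * Zpoly G x (U.filter fun k => ¬ G.Adj j k) := by
  unfold Zpoly
  have hnot : ∀ I ∈ U.powerset, j ∉ I := fun I hI h => hj (Finset.mem_powerset.1 hI h)
  simp only [Finset.sum_filter]
  rw [Finset.sum_powerset_insert hj]
  congr 1
  rw [Finset.mul_sum, ← Finset.sum_subset
    (Finset.powerset_mono.2 (Finset.filter_subset (fun k => ¬ G.Adj j k) U))]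
  · refine Finset.sum_congr rfl fun I hI => ?_
    rw [Finset.mem_powerset] at hI
    have hadj : ∀ k ∈ I, ¬ G.Adj j k := fun k hk => (Finset.mem_filter.1 (hI hk)).2
    have hjI : j ∉ I := fun h => hj (Finset.mem_filter.1 (hI h)).1
    rw [Finset.prod_insert hjI, mul_ite, mul_zero]
    refine if_congr ⟨fun h a ha b hb => h a (Finset.mem_insert_of_mem ha) b
      (Finset.mem_insert_of_mem hb), fun h a ha b hb => ?_⟩ rfl rfl
    rcases Finset.mem_insert.1 ha with rfl | haI <;> rcases Finset.mem_insert.1 hb with rfl | hbI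
    · exact G.irrefl
    · exact hadj b hbI
    · exact fun hab => hadj a haI hab.symm
    · exact h a haI b hbI
  · intro I hI hI'
    refine if_neg fun h => hI' (Finset.mem_powerset.2 fun k hk => Finset.mem_filter.2
      ⟨Finset.mem_powerset.1 hI hk, h j (Finset.mem_insert_self _ _) k
        (Finset.mem_insert_of_mem hk)⟩)

/-- Telescoping a lower bound on the ratios `Z(T) / Z(T \ k)` over a set of deleted vertices. -/
theorem prod_mul_Zpoly_sdiff_le (G : SimpleGraph (Fin n)) (x c : Fin n → ℝ)
    (U W : Finset (Fin n)) (hW : W ⊆ U) (hc : ∀ k ∈ W, 0 ≤ c k)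
    (h : ∀ T ⊆ U, ∀ k ∈ T, k ∈ W → c k * Zpoly G x (T.erase k) ≤ Zpoly G x T) :
    (∏ k ∈ W, c k) * Zpoly G x (U \ W) ≤ Zpoly G x U := by
  induction W using Finset.induction_on with
  | empty => simp
  | insert k W hk ih =>
    have hle := ih ((Finset.subset_insert _ _).trans hW)
      (fun l hl => hc l (Finset.mem_insert_of_mem hl))
      (fun T hT l hl hlW => h T hT l hl (Finset.mem_insert_of_mem hlW))
    have hstep := h (U \ W) Finset.sdiff_subset k
      (Finset.mem_sdiff.2 ⟨hW (Finset.mem_insert_self _ _), hk⟩) (Finset.mem_insert_self _ _)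
    rw [← Finset.sdiff_insert] at hstep
    have hprod : 0 ≤ ∏ l ∈ W, c l :=
      Finset.prod_nonneg fun l hl => hc l (Finset.mem_insert_of_mem hl)
    rw [Finset.prod_insert hk]
    calc c k * (∏ l ∈ W, c l) * Zpoly G x (U \ insert k W)
        = (∏ l ∈ W, c l) * (c k * Zpoly G x (U \ insert k W)) := by ring
      _ ≤ (∏ l ∈ W, c l) * Zpoly G x (U \ W) := mul_le_mul_of_nonneg_left hstep hprod
      _ ≤ Zpoly G x U := hle

open Classical in
theorem prod_mul_Zpoly_filter_not_adj_le (G : SimpleGraph (Fin n)) (x c : Fin n → ℝ) (j : Fin n)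
    (U : Finset (Fin n)) (hc : ∀ k, G.Adj j k → 0 ≤ c k)
    (h : ∀ T ⊆ U, ∀ k ∈ T, G.Adj j k → c k * Zpoly G x (T.erase k) ≤ Zpoly G x T) :
    (∏ k ∈ U, if G.Adj j k then c k else 1) * Zpoly G x (U.filter fun k => ¬ G.Adj j k)
      ≤ Zpoly G x U := by
  have := prod_mul_Zpoly_sdiff_le G x c U (U.filter (G.Adj j)) (Finset.filter_subset _ _)
    (fun k hk => hc k (Finset.mem_filter.1 hk).2)
    (fun T hT k hk hkW => h T hT k hk (Finset.mem_filter.1 hkW).2)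
  rwa [Finset.prod_filter, ← Finset.filter_not] at this

open Classical in
/-- The non-backtracking ratio bound: if `i ∉ T` is adjacent to `j ∈ T`, then
`Z(T) ≥ (1 - r_{(i,j)}) Z(T \ j)`. -/
theorem one_sub_mul_Zpoly_erase_le (G : SimpleGraph (Fin n)) (p : Fin n → ℝ)
    (ra : Fin n × Fin n → ℝ)
    (hra : ∀ i j, G.Adj i j → 0 ≤ ra (i, j) ∧ ra (i, j) < 1)
    (h2 : ∀ i j, G.Adj i j →
      p j ≤ ra (i, j) * ∏ k : Fin n, if G.Adj j k ∧ k ≠ i then 1 - ra (j, k) else 1)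
    (T : Finset (Fin n)) (hT : ∀ T' ⊂ T, 0 < Zpoly G (fun i => -p i) T')
    (i j : Fin n) (hj : j ∈ T) (hi : i ∉ T) (hij : G.Adj i j) :
    (1 - ra (i, j)) * Zpoly G (fun i => -p i) (T.erase j) ≤ Zpoly G (fun i => -p i) T := by
  induction T using Finset.strongInduction generalizing i j with
  | H T ih =>
    have hss : T.erase j ⊂ T := Finset.erase_ssubset hj
    have htel := prod_mul_Zpoly_filter_not_adj_le G (fun i => -p i) (fun k => 1 - ra (j, k)) j
      (T.erase j) (fun k hk => by linarith [(hra j k hk).2])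
      (fun T' hT' k hk hjk => ih T' (hT'.trans_ssubset hss)
        (fun T'' hT'' => hT T'' (hT''.trans (hT'.trans_ssubset hss))) j k hk
        (fun h => Finset.notMem_erase j T (hT' h)) hjk)
    have hrec := Zpoly_insert G (fun i => -p i) (Finset.notMem_erase j T)
    rw [Finset.insert_erase hj] at hrec
    have hpos := hT ((T.erase j).filter fun k => ¬ G.Adj j k)
      ((Finset.filter_subset _ _).trans_ssubset hss)
    have hprod : (∏ k : Fin n, if G.Adj j k ∧ k ≠ i then 1 - ra (j, k) else 1) ≤
        ∏ k ∈ T.erase j, if G.Adj j k then 1 - ra (j, k) else 1 := by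
      rw [← Finset.prod_mul_prod_compl (T.erase j)]
      have hnn : ∀ k, 0 ≤ (if G.Adj j k ∧ k ≠ i then 1 - ra (j, k) else 1) := fun k => by
        split_ifs with hk
        · linarith [(hra j k hk.1).2]
        · exact zero_le_one
      refine (mul_le_of_le_one_right (Finset.prod_nonneg fun k _ => hnn k)
        (Finset.prod_le_one (fun k _ => hnn k) fun k _ => ?_)).trans_eq
        (Finset.prod_congr rfl fun k hk => ?_)
      · split_ifs with hk
        · linarith [(hra j k hk.1).1]
        · exact le_rfl
      · have hki : k ≠ i := fun h => hi (h ▸ Finset.mem_of_mem_erase hk)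
        simp [hki]
    have hr0 := (hra i j hij).1
    have hp := (h2 i j hij).trans (mul_le_mul_of_nonneg_left hprod hr0)
    have := mul_le_mul_of_nonneg_right hp hpos.le
    have := mul_le_mul_of_nonneg_left htel hr0
    rw [hrec]
    linarith

open Classical in
/-- **Non-backtracking LLL.** If there are `r_i ∈ [0,1)` for vertices and
`r_a ∈ [0,1)` for oriented edges `a = (i,j)` such that
`p_i ≤ r_i ∏_{j ∈ Γ_i} (1 - r_{(j,i)})` and, for each oriented edge `(i,j)`,
`p_j ≤ r_{(i,j)} ∏_{(j,k) : k ≠ i} (1 - r_{(j,k)})`, then `Z_G(-p; S) > 0` for all `S`. -/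
theorem nonbacktracking_LLL (G : SimpleGraph (Fin n)) (p : Fin n → ℝ)
    (hp : ∀ i, 0 ≤ p i ∧ p i < 1)
    (r : Fin n → ℝ) (ra : Fin n × Fin n → ℝ)
    (hr : ∀ i, 0 ≤ r i ∧ r i < 1)
    (hra : ∀ i j, G.Adj i j → 0 ≤ ra (i, j) ∧ ra (i, j) < 1)
    (h1 : ∀ i, p i ≤ r i * ∏ j : Fin n, if G.Adj i j then 1 - ra (j, i) else 1)
    (h2 : ∀ i j, G.Adj i j →
      p j ≤ ra (i, j) * ∏ k : Fin n, if G.Adj j k ∧ k ≠ i then 1 - ra (j, k) else 1) :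
    ∀ S : Finset (Fin n), 0 < Zpoly G (fun i => -p i) S := by
  intro S
  induction S using Finset.strongInduction with
  | H S ih =>
    by_contra hS
    rw [not_lt] at hS
    have hratio := one_sub_mul_Zpoly_erase_le G p ra hra h2
    have hclosed : ∀ i ∈ S, ∀ k, G.Adj i k → k ∈ S := by
      intro i hi k hik
      by_contra hk
      have hle := hratio S ih k i hi hk hik.symm
      have := mul_pos (sub_pos.2 (hra k i hik.symm).2) (ih _ (Finset.erase_ssubset hi))
      linarith
    have hne : S.Nonempty := by
      rw [Finset.nonempty_iff_ne_empty]
      rintro rfl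
      rw [Zpoly_empty] at hS
      linarith
    have hfactor : ∀ i k, 0 < (if G.Adj i k then 1 - ra (i, k) else 1) := fun i k => by
      split_ifs with hik
      · linarith [(hra i k hik).2]
      · exact zero_lt_one
    have hfactor' : ∀ i k, 0 < (if G.Adj i k then 1 - ra (k, i) else 1) := fun i k => by
      simpa only [G.adj_comm] using hfactor k i
    have hlower : ∀ i ∈ S, (∏ k ∈ S, if G.Adj i k then 1 - ra (i, k) else 1) ≤ p i := by
      intro i hi
      have hss : S.erase i ⊂ S := Finset.erase_ssubset hi
      have htel := prod_mul_Zpoly_filter_not_adj_le G (fun i => -p i) (fun k => 1 - ra (i, k)) i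
        (S.erase i) (fun k hk => by linarith [(hra i k hk).2])
        (fun T hT k hk hik => hratio T (fun T' hT' => ih T' (hT'.trans (hT.trans_ssubset hss)))
          i k hk (fun h => Finset.notMem_erase i S (hT h)) hik)
      have hrec := Zpoly_insert G (fun i => -p i) (Finset.notMem_erase i S)
      rw [Finset.insert_erase hi] at hrec
      have hpos := ih ((S.erase i).filter fun k => ¬ G.Adj i k)
        ((Finset.filter_subset _ _).trans_ssubset hss)
      rw [← Finset.mul_prod_erase S _ hi, if_neg G.irrefl, one_mul]
      exact le_of_mul_le_mul_right (by linarith) hpos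
    have hupper : ∀ i ∈ S, p i < ∏ k ∈ S, if G.Adj i k then 1 - ra (k, i) else 1 := by
      intro i hi
      rw [Finset.prod_subset (Finset.subset_univ S)
        fun k _ hk => if_neg fun hik => hk (hclosed i hi k hik)]
      exact (h1 i).trans_lt
        (mul_lt_of_lt_one_left (Finset.prod_pos fun k _ => hfactor' i k) (hr i).2)
    have hlt := Finset.prod_lt_prod_of_nonempty
      (fun i _ => Finset.prod_pos fun k _ => hfactor i k)
      (fun i hi => (hlower i hi).trans_lt (hupper i hi)) hne
    rw [Finset.prod_comm] at hlt
    simp only [G.adj_comm] at hlt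
    exact lt_irrefl _ hlt
end

section
/- (Supermodular Local Lemma) Let G be a finite simple graph on vertex set [n], p ∈ [0,1)^n, and let f be a supermodular function with f(∅) > 0 that factorizes according to p, G. If there exist r_1, …, r_n ∈ [0,1) such that p_i ≤ r_i · ∏_{j∈Γ_i} (1 − r_j) for all i ∈ [n], then f(S) ≥ f(∅) · ∏_{i∈S} (1 − r_i) > 0 for every S ⊆ [n]. -/
open Finset

variable {n : ℕ}

/-- `f : 2^{[n]} → ℝ` is supermodular: discrete derivatives are increasing. -/
def Supermodular (f : Finset (Fin n) → ℝ) : Prop :=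
  ∀ (i : Fin n) (S T : Finset (Fin n)), S ⊆ T → i ∉ T →
    f (insert i S) - f S ≤ f (insert i T) - f T

/-- `f` factorizes according to `p, G`: `f(S ∪ {i}) ≥ (1 - p_i) f(S)` whenever `S` contains
neither `i` nor any neighbor of `i`. -/
def Factorizes (f : Finset (Fin n) → ℝ) (p : Fin n → ℝ) (G : SimpleGraph (Fin n)) : Prop :=
  ∀ (i : Fin n) (S : Finset (Fin n)), (∀ j ∈ S, j ≠ i ∧ ¬ G.Adj i j) →
    (1 - p i) * f S ≤ f (insert i S)

/-- If inserting an element `i` into a proper subset of `A ∪ B` shrinks `f` by at most the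
factor `c i`, then inserting all of `B` into `A` shrinks `f` by at most `∏ i ∈ B, c i`. -/
theorem mul_prod_le_of_insert {α : Type*} [DecidableEq α] {f : Finset α → ℝ} {c : α → ℝ}
    (hc : ∀ i, 0 ≤ c i) (A B : Finset α) (hAB : Disjoint A B)
    (hstep : ∀ T ⊂ A ∪ B, ∀ i ∉ T, f T * c i ≤ f (insert i T)) :
    f A * ∏ i ∈ B, c i ≤ f (A ∪ B) := by
  induction B using Finset.induction_on with
  | empty => simp
  | insert b B hb ih =>
    rw [disjoint_insert_right] at hAB
    have hb' : b ∉ A ∪ B := by simp [hAB.1, hb]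
    rw [union_insert] at hstep ⊢
    have hss := ssubset_insert hb'
    calc f A * ∏ i ∈ insert b B, c i = (f A * ∏ i ∈ B, c i) * c b := by
          rw [prod_insert hb]; ring
      _ ≤ f (A ∪ B) * c b :=
          mul_le_mul_of_nonneg_right
            (ih hAB.2 fun T hT => hstep T (hT.trans hss)) (hc b)
      _ ≤ f (insert b (A ∪ B)) := hstep _ hss b hb'

open Classical in
/-- **Supermodular Local Lemma.** If `f` is a nonnegative supermodular function
with `f(∅) > 0` factorizing according to `p, G`, and there are `r_i ∈ [0,1)` with
`p_i ≤ r_i ∏_{j ∈ Γ_i} (1 - r_j)` for all `i`, then `f(S) ≥ f(∅) ∏_{i ∈ S} (1 - r_i) > 0`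
for every `S ⊆ [n]`. -/
theorem supermodular_LLL (G : SimpleGraph (Fin n)) (p : Fin n → ℝ)
    (hp : ∀ i, 0 ≤ p i ∧ p i < 1)
    (f : Finset (Fin n) → ℝ) (hf0 : ∀ S, 0 ≤ f S)
    (hsm : Supermodular f) (hfe : 0 < f ∅) (hfac : Factorizes f p G)
    (r : Fin n → ℝ) (hr : ∀ i, 0 ≤ r i ∧ r i < 1)
    (hcond : ∀ i, p i ≤ r i * ∏ j : Fin n, if G.Adj i j then 1 - r j else 1) :
    ∀ S : Finset (Fin n),
      f ∅ * ∏ i ∈ S, (1 - r i) ≤ f S ∧ 0 < f ∅ * ∏ i ∈ S, (1 - r i) := by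
  have hpos : ∀ i, 0 < 1 - r i := fun i => sub_pos.2 (hr i).2
  have step : ∀ (S : Finset (Fin n)) (i : Fin n), i ∉ S → f S * (1 - r i) ≤ f (insert i S) := by
    intro S
    induction S using Finset.strongInduction with
    | H S ih =>
      intro i hi
      have hprod : f (S.filter fun j => ¬ G.Adj i j) * ∏ j ∈ S with G.Adj i j, (1 - r j) ≤ f S := by
        have h := mul_prod_le_of_insert (f := f) (c := fun j => 1 - r j)
          (fun j => (hpos j).le) (S.filter fun j => ¬ G.Adj i j) (S.filter fun j => G.Adj i j)
          (disjoint_filter_filter_not S S _).symm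
          (fun T hT j hj => ih T (by rwa [union_comm, filter_union_filter_not_eq] at hT) j hj)
        rwa [union_comm, filter_union_filter_not_eq] at h
      have hp_le : p i ≤ r i * ∏ j ∈ S with G.Adj i j, (1 - r j) := by
        refine (hcond i).trans (mul_le_mul_of_nonneg_left ?_ (hr i).1)
        rw [← prod_filter]
        rw [← prod_sdiff (filter_subset_filter (fun j => G.Adj i j) (subset_univ S))]
        exact mul_le_of_le_one_left (prod_nonneg fun j _ => (hpos j).le)
          (prod_le_one (fun j _ => (hpos j).le) fun j _ => sub_le_self 1 (hr j).1)
      have hfac_i := hfac i (S.filter fun j => ¬ G.Adj i j) fun j hj =>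
        ⟨fun h => hi (h ▸ (mem_filter.1 hj).1), (mem_filter.1 hj).2⟩
      have hsm_i := hsm i _ S (filter_subset (fun j => ¬ G.Adj i j) S) hi
      have h₁ := mul_le_mul_of_nonneg_right hp_le (hf0 (S.filter fun j => ¬ G.Adj i j))
      have h₂ := mul_le_mul_of_nonneg_left hprod (hr i).1
      linarith
  intro S
  refine ⟨?_, mul_pos hfe (prod_pos fun i _ => hpos i)⟩
  simpa using mul_prod_le_of_insert (f := f) (c := fun i => 1 - r i)
    (fun i => (hpos i).le) ∅ S (disjoint_empty_left S) fun T _ i hi => step T i hi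
end

section
/- Let G be a finite simple graph on vertex set [n] and p ∈ [0,1)^n. The following are equivalent: (a) Z_G(−p; S) > 0 for every S ⊆ [n]; (b) for every i ∈ [n] and every S ⊆ [n]∖{i}, Z_G(−p; S) ≠ 0 and ratio(p; (i,S)) := 1 − Z_G(−p; S∪{i}) / Z_G(−p; S) < 1. -/
open Finset

variable {n : ℕ}

/-- `Z_G(-p; S) > 0` for every `S ⊆ [n]` iff for every `i` and every
`S ⊆ [n] ∖ {i}`, `Z_G(-p; S) ≠ 0` and `ratio(p; (i,S)) = 1 - Z_G(-p; S ∪ {i})/Z_G(-p; S) < 1`. -/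
theorem shearer_iff_ratio_lt_one (G : SimpleGraph (Fin n)) (p : Fin n → ℝ)
    (hp : ∀ i, 0 ≤ p i ∧ p i < 1) :
    (∀ S : Finset (Fin n), 0 < Zpoly G (fun i => -p i) S) ↔
      ∀ (i : Fin n) (S : Finset (Fin n)), i ∉ S →
        Zpoly G (fun j => -p j) S ≠ 0 ∧
          1 - Zpoly G (fun j => -p j) (insert i S) / Zpoly G (fun j => -p j) S < 1 := by
  constructor
  · intro h i S _
    exact ⟨(h S).ne', sub_lt_self 1 (div_pos (h _) (h S))⟩
  · intro h S
    induction S using Finset.induction_on with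
    | empty => simp [Zpoly, Finset.filter_singleton]
    | insert i S hi ih => exact (div_pos_iff_of_pos_right ih).1 (by linarith [(h i S hi).2])
end

section
/- Let G be a finite simple graph on vertex set [n], p ∈ [0,1)^n, and let W be a finite set of walks on G. Suppose L: W → [0,1) satisfies p_{t(w)} ≤ L(w) · ∏_{y∈Ext(w)} (1 − L(y)) for all w ∈ W. Then the function L̂: W → [0,1) defined by the recurrence L̂(w) = p_{t(w)} · ∏_{y∈Ext(w)} 1/(1 − L̂(y)) is well-defined (the recursion is well-founded since every extension of w is strictly longer and W is finite), takes values in [0,1), and satisfies L̂(w) ≤ L(w) for all w ∈ W. -/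
open Finset

variable {n : ℕ}

open Classical in
/-- `∏_{y ∈ Ext(w)} 1/(1 - L y)`, extensions taken within `W`. -/
noncomputable def extProdInv (W : Set (List (Fin n))) (L : List (Fin n) → ℝ)
    (w : List (Fin n)) : ℝ :=
  ∏ z : Fin n, if z :: w ∈ W then (1 - L (z :: w))⁻¹ else 1

theorem extProdInv_eq_inv (W : Set (List (Fin n))) (L : List (Fin n) → ℝ)
    (w : List (Fin n)) : extProdInv W L w = (extProd W L w)⁻¹ := by
  unfold extProdInv extProd
  rw [← Finset.prod_inv_distrib]
  refine Finset.prod_congr rfl fun z _ => ?_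
  split_ifs <;> simp

theorem extProdInv_congr {W : Set (List (Fin n))} {L L' : List (Fin n) → ℝ}
    {w : List (Fin n)} (h : ∀ z, L (z :: w) = L' (z :: w)) :
    extProdInv W L w = extProdInv W L' w := by
  simp only [extProdInv, h]

theorem extProd_anti {W : Set (List (Fin n))} {L L' : List (Fin n) → ℝ}
    (hle : ∀ w ∈ W, L w ≤ L' w) (hlt : ∀ w ∈ W, L' w < 1) (w : List (Fin n)) :
    extProd W L' w ≤ extProd W L w := by
  refine Finset.prod_le_prod (fun z _ => ?_) fun z _ => ?_
  · split_ifs with hz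
    · exact (sub_pos.mpr (hlt _ hz)).le
    · exact zero_le_one
  · split_ifs with hz
    · exact sub_le_sub_left (hle _ hz) 1
    · exact le_rfl

/-- The recurrence `L̂(w) = p_{t(w)} ∏_{y ∈ Ext(w)} 1/(1 - L̂(y))` unfolded to a given depth,
starting from `0`. -/
noncomputable def lhatIter (p : Fin n → ℝ) (W : Set (List (Fin n))) :
    ℕ → List (Fin n) → ℝ
  | 0, _ => 0
  | k + 1, w => if h : w ≠ [] then p (w.head h) * extProdInv W (lhatIter p W k) w else 0

theorem lhatIter_mem_Icc {p : Fin n → ℝ} (hp : ∀ i, 0 ≤ p i) {W : Set (List (Fin n))}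
    {L : List (Fin n) → ℝ} (hL : ∀ w ∈ W, 0 ≤ L w ∧ L w < 1)
    (hineq : ∀ w, w ∈ W → ∀ h : w ≠ [], p (w.head h) ≤ L w * extProd W L w) (k : ℕ) :
    ∀ w ∈ W, lhatIter p W k w ∈ Set.Icc 0 (L w) := by
  induction k with
  | zero => exact fun w hw => ⟨le_rfl, (hL w hw).1⟩
  | succ k ih =>
    intro w hw
    have hlt : ∀ y ∈ W, L y < 1 := fun y hy => (hL y hy).2
    have hpos := extProd_pos (fun y hy => (ih y hy).2.trans_lt (hlt y hy)) w
    rw [lhatIter]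
    split_ifs with h
    · rw [extProdInv_eq_inv, ← div_eq_mul_inv]
      refine ⟨div_nonneg (hp _) hpos.le, (div_le_iff₀ hpos).mpr ((hineq w hw h).trans ?_)⟩
      exact mul_le_mul_of_nonneg_left (extProd_anti (fun y hy => (ih y hy).2) hlt w) (hL w hw).1
    · exact ⟨le_rfl, (hL w hw).1⟩

/-- For a finite set `W` of walks on `G` and `L : W → [0,1)` satisfying
`p_{t(w)} ≤ L(w) ∏_{y ∈ Ext(w)} (1 - L(y))`, the function `L̂` defined by the recurrence
`L̂(w) = p_{t(w)} ∏_{y ∈ Ext(w)} 1/(1 - L̂(y))` is well-defined on `W`, takes values in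
`[0,1)`, and satisfies `L̂(w) ≤ L(w)` for all `w ∈ W`. -/
theorem lhat_exists_le (G : SimpleGraph (Fin n)) (p : Fin n → ℝ)
    (hp : ∀ i, 0 ≤ p i ∧ p i < 1)
    (W : Set (List (Fin n))) (hWfin : W.Finite)
    (hW : ∀ w ∈ W, w ≠ [] ∧ w.Chain' G.Adj)
    (L : List (Fin n) → ℝ) (hL : ∀ w ∈ W, 0 ≤ L w ∧ L w < 1)
    (hineq : ∀ w, w ∈ W → ∀ h : w ≠ [], p (w.head h) ≤ L w * extProd W L w) :
    ∃ Lhat : List (Fin n) → ℝ,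
      (∀ w, w ∈ W → ∀ h : w ≠ [], Lhat w = p (w.head h) * extProdInv W Lhat w) ∧
      (∀ w ∈ W, 0 ≤ Lhat w ∧ Lhat w < 1) ∧
      (∀ w ∈ W, Lhat w ≤ L w) := by
  obtain ⟨M, hM⟩ := (hWfin.image List.length).bddAbove
  have hlen : ∀ w ∈ W, w.length ≤ M := fun w hw => hM (Set.mem_image_of_mem _ hw)
  have hbound := lhatIter_mem_Icc (fun i => (hp i).1) hL hineq
  refine ⟨fun w => lhatIter p W (M + 1 - w.length) w, fun w hw h => ?_, fun w hw => ?_,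
    fun w hw => (hbound _ w hw).2⟩
  · have hsucc : M + 1 - w.length = (M - w.length) + 1 := by
      have := hlen w hw
      omega
    simp only [hsucc, lhatIter, dif_pos h]
    congr 1
    exact extProdInv_congr fun z => by simp
  · exact ⟨(hbound _ w hw).1, (hbound _ w hw).2.trans_lt (hL w hw).2⟩
end

section
/- Let n ≥ 1 and let W be the set of nonempty strictly decreasing sequences of elements of [n], viewed as walks on the complete graph K_n (so that for w ∈ W, Ext(w) = {wz : z < t(w)}). Then p ∈ [0,1)^n is valid for W if and only if Σ_{i=1}^n p_i < 1. -/
open Finset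

variable {n : ℕ}

/-- The nonempty strictly decreasing sequences on `[n]`, viewed as walks on the complete
graph `K_n`.  In our representation (terminal vertex first) these are the nonempty strictly
increasing lists, and `Ext(w) = {z :: w : z < t(w)}`. -/
def DecSeqs (n : ℕ) : Set (List (Fin n)) :=
  {w | w ≠ [] ∧ w.Chain' (· < ·)}

theorem Fin.filter_val_lt_succ {k : ℕ} (hk : k < n) :
    univ.filter (fun z : Fin n => z.val < k + 1) =
      insert ⟨k, hk⟩ (univ.filter (fun z : Fin n => z.val < k)) := by
  ext z
  simp only [mem_filter, mem_univ, true_and, mem_insert, Fin.ext_iff]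
  omega

theorem Fin.filter_val_lt_self : univ.filter (fun z : Fin n => z.val < n) = univ :=
  filter_true_of_mem fun z _ => z.isLt

theorem cons_cons_mem_decSeqs_iff {z i : Fin n} {w : List (Fin n)} (h : i :: w ∈ DecSeqs n) :
    z :: i :: w ∈ DecSeqs n ↔ z < i := by
  have h2 : (i :: w).IsChain (· < ·) := h.2
  change (_ ≠ [] ∧ (z :: i :: w).IsChain (· < ·)) ↔ _
  simp [List.isChain_cons_cons, h2]

theorem singleton_mem_decSeqs (z : Fin n) : [z] ∈ DecSeqs n :=
  ⟨List.cons_ne_nil _ _, List.isChain_singleton _⟩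

theorem extProd_decSeqs_cons (L : List (Fin n) → ℝ) {i : Fin n} {w : List (Fin n)}
    (h : i :: w ∈ DecSeqs n) :
    extProd (DecSeqs n) L (i :: w) =
      ∏ z : Fin n with z.val < i.val, (1 - L (z :: i :: w)) := by
  rw [extProd, prod_filter]
  refine prod_congr rfl fun z _ => ?_
  simp only [cons_cons_mem_decSeqs_iff h, Fin.lt_def]

theorem prod_one_sub_le_one_sub_sum {p : Fin n → ℝ} {L : List (Fin n) → ℝ}
    (hL : ∀ w ∈ DecSeqs n, 0 ≤ L w ∧ L w < 1)
    (hp : ∀ w, w ∈ DecSeqs n → ∀ h : w ≠ [], p (w.head h) ≤ L w * extProd (DecSeqs n) L w)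
    (k : ℕ) (hk : k ≤ n) (w : List (Fin n))
    (hw : ∀ z : Fin n, z.val < k → z :: w ∈ DecSeqs n) :
    ∏ z : Fin n with z.val < k, (1 - L (z :: w)) ≤ 1 - ∑ z : Fin n with z.val < k, p z := by
  induction k generalizing w with
  | zero => simp
  | succ k ih =>
    have hkn : k < n := hk
    set i : Fin n := ⟨k, hkn⟩
    have hiw : i :: w ∈ DecSeqs n := hw i (Nat.lt_succ_self k)
    have hprod := ih hkn.le w fun z hz => hw z (hz.trans (Nat.lt_succ_self k))
    have hext := ih hkn.le (i :: w) fun z hz => (cons_cons_mem_decSeqs_iff hiw).2 hz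
    have hpi := hp _ hiw (List.cons_ne_nil _ _)
    rw [extProd_decSeqs_cons L hiw, List.head_cons] at hpi
    obtain ⟨h0, h1⟩ := hL _ hiw
    rw [Fin.filter_val_lt_succ hkn, prod_insert (by simp), sum_insert (by simp)]
    have hmul := mul_le_mul_of_nonneg_left hprod (sub_nonneg.2 h1.le)
    have hmul' := mul_le_mul_of_nonneg_left hext h0
    linarith

theorem prod_one_sub_div_eq_one_sub_sum {p : Fin n → ℝ}
    (hlt : ∀ k, ∑ z : Fin n with z.val < k, p z < 1) (k : ℕ) (hk : k ≤ n) :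
    ∏ z : Fin n with z.val < k, (1 - p z / (1 - ∑ j : Fin n with j.val < z.val, p j)) =
      1 - ∑ z : Fin n with z.val < k, p z := by
  induction k with
  | zero => simp
  | succ k ih =>
    have hkn : k < n := hk
    have hne : 1 - ∑ z : Fin n with z.val < k, p z ≠ 0 := (sub_pos.2 (hlt k)).ne'
    rw [Fin.filter_val_lt_succ hkn, prod_insert (by simp), sum_insert (by simp), ih hkn.le]
    field_simp
    ring

/-- For `n ≥ 1`, `p ∈ [0,1)ⁿ` is valid for the set of nonempty strictly
decreasing sequences on `[n]` iff `Σ_i p_i < 1`. -/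
theorem valid_decreasing_iff_sum_lt_one (hn : 1 ≤ n) (p : Fin n → ℝ)
    (hp : ∀ i, 0 ≤ p i ∧ p i < 1) :
    IsValid p (DecSeqs n) ↔ ∑ i : Fin n, p i < 1 := by
  constructor
  · rintro ⟨L, hL, hpL⟩
    have h := prod_one_sub_le_one_sub_sum hL hpL n le_rfl [] fun z _ => singleton_mem_decSeqs z
    rw [Fin.filter_val_lt_self] at h
    have hpos : 0 < ∏ z : Fin n, (1 - L [z]) :=
      prod_pos fun z _ => sub_pos.2 (hL _ (singleton_mem_decSeqs z)).2
    linarith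
  · intro hsum
    have hlt : ∀ k, ∑ z : Fin n with z.val < k, p z < 1 := fun k =>
      (sum_le_sum_of_subset_of_nonneg (filter_subset _ _) fun i _ _ => (hp i).1).trans_lt hsum
    refine ⟨fun w => w.head?.elim 0 fun i => p i / (1 - ∑ j : Fin n with j.val < i.val, p j),
      ?_, ?_⟩
    · rintro (_ | ⟨i, w⟩) hw
      · exact absurd rfl hw.1
      · have hpos := sub_pos.2 (hlt i.val)
        have hsucc := hlt (i.val + 1)
        rw [Fin.filter_val_lt_succ i.isLt, sum_insert (by simp), Fin.eta] at hsucc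
        simp only [List.head?_cons, Option.elim_some]
        exact ⟨div_nonneg (hp i).1 hpos.le, (div_lt_one hpos).2 (by linarith)⟩
    · rintro (_ | ⟨i, w⟩) hw h
      · exact absurd rfl h
      · rw [extProd_decSeqs_cons _ hw]
        simp only [List.head?_cons, Option.elim_some, List.head_cons]
        rw [prod_one_sub_div_eq_one_sub_sum hlt i.val i.isLt.le,
          div_mul_cancel₀ _ (sub_pos.2 (hlt i.val)).ne']
end
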